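/- The number of labeled trees on n vertices (n ≥ 2) in which vertex i has degree d_i, where each d_i ≥ 1 and ∑ d_i = 2(n-1), equals the multinomial coefficient (n-2)! / ((d_1-1)! · ... · (d_n-1)!). -/

import Mathlib

namespace SimpleGraph

/-- The graph obtained from `H` by adding the new vertex `none` as a leaf attached to `w`. -/
def attachLeaf {W : Type*} (H : SimpleGraph W) (w : W) : SimpleGraph (Option W) where
  Adj
    | none, none => False
    | none, some x => x = w
    | some x, none => x = w
    | some x, some y => H.Adj x y
  symm := ⟨by
    rintro (_ | x) (_ | y) h
    exacts [h, h, h, H.adj_symm h]⟩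
  loopless := ⟨by
    rintro (_ | x) h
    exacts [h, H.loopless.irrefl x h]⟩

section attachLeaf

variable {W : Type*} (H : SimpleGraph W) (w x y : W)

@[simp] lemma attachLeaf_adj_none_some : (H.attachLeaf w).Adj none (some x) ↔ x = w := Iff.rfl

@[simp] lemma attachLeaf_adj_some_none : (H.attachLeaf w).Adj (some x) none ↔ x = w := Iff.rfl

@[simp] lemma attachLeaf_adj_some_some :
    (H.attachLeaf w).Adj (some x) (some y) ↔ H.Adj x y := Iff.rfl

lemma connected_attachLeaf_iff : (H.attachLeaf w).Connected ↔ H.Connected := by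
  constructor
  · intro h
    have key (a b : Option W) (hab : (H.attachLeaf w).Reachable a b) :
        H.Reachable (a.getD w) (b.getD w) := by
      obtain ⟨p⟩ := hab
      induction p with
      | nil => rfl
      | @cons a b c hadj _ ih =>
        refine Reachable.trans ?_ ih
        rcases a with _ | a <;> rcases b with _ | b
        · rfl
        · simp_all
        · simp_all
        · exact Adj.reachable hadj
    have : Nonempty W := ⟨w⟩
    exact ⟨fun a b => key (some a) (some b) (h.preconnected _ _)⟩
  · intro h
    rw [connected_iff_exists_forall_reachable]
    refine ⟨some w, ?_⟩
    rintro (_ | x)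
    · exact Adj.reachable (by simp)
    · exact (h.preconnected w x).map ⟨some, fun {a b} hab => hab⟩

lemma card_neighborSet_attachLeaf_none : Nat.card ((H.attachLeaf w).neighborSet none) = 1 := by
  rw [Nat.card_coe_set_eq, Set.ncard_eq_one]
  refine ⟨some w, ?_⟩
  ext (_ | x) <;> simp

lemma card_neighborSet_attachLeaf_some [Finite W] [DecidableEq W] :
    Nat.card ((H.attachLeaf w).neighborSet (some x)) =
      Nat.card (H.neighborSet x) + if x = w then 1 else 0 := by
  simp only [Nat.card_coe_set_eq]
  rw [← Set.ncard_image_of_injective (H.neighborSet x) (Option.some_injective W)]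
  split_ifs with h
  · rw [← Set.ncard_insert_of_notMem (a := none) (by simp)]
    congr 1
    ext (_ | y) <;> simp [h]
  · congr 1
    ext (_ | y) <;> simp [h]

lemma attachLeaf_comap_some {G : SimpleGraph (Option W)} (h : G.neighborSet none = {some w}) :
    (G.comap some).attachLeaf w = G := by
  have hw (x : W) : G.Adj none (some x) ↔ x = w := by
    simpa using Set.ext_iff.1 h (some x)
  ext (_ | x) (_ | y)
  · simp
  · simp [hw]
  · simp [G.adj_comm (some x), hw]
  · simp

end attachLeaf

/-- The set of connected graphs with prescribed degrees. -/
def connectedWithDegrees {V : Type*} (d : V → ℕ) : Set (SimpleGraph V) :=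
  {G | G.Connected ∧ ∀ i, Nat.card (G.neighborSet i) = d i}

lemma isTree_iff_connected_of_sum_eq {V : Type*} [Fintype V] {d : V → ℕ} {G : SimpleGraph V}
    (hsum : ∑ i, d i = 2 * (Fintype.card V - 1)) (hG : ∀ i, Nat.card (G.neighborSet i) = d i) :
    G.IsTree ↔ G.Connected := by
  classical
  rw [isTree_iff_connected_and_card, and_iff_left_iff_imp]
  intro h
  have : Nonempty V := h.nonempty
  have hpos : 0 < Fintype.card V := Fintype.card_pos
  have hs := G.sum_degrees_eq_twice_card_edges
  have hdeg (i : V) : G.degree i = d i := by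
    rw [← hG, Nat.card_eq_fintype_card, card_neighborSet_eq_degree]
  simp only [hdeg, hsum, edgeFinset_card] at hs
  simp only [Nat.card_eq_fintype_card]
  omega

lemma card_connectedWithDegrees_congr {V W : Type*} (e : V ≃ W) (d : W → ℕ) :
    Nat.card (connectedWithDegrees (d ∘ e)) = Nat.card (connectedWithDegrees d) := by
  refine Nat.card_congr (e.simpleGraph.subtypeEquiv fun G => ?_)
  let φ : e.simpleGraph G ≃g G := Iso.comap e.symm G
  refine and_congr φ.connected_iff.symm (e.forall_congr fun i => ?_)
  rw [Nat.card_congr (φ.mapNeighborSet (e i)), show φ (e i) = i from e.symm_apply_apply i]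
  rfl

lemma card_connectedWithDegrees_option {W : Type*} [Fintype W] [DecidableEq W]
    (d : Option W → ℕ) (hd : ∀ i, 1 ≤ d i) (hnone : d none = 1) :
    Nat.card (connectedWithDegrees d) =
      ∑ w, Nat.card (connectedWithDegrees fun x => d (some x) - if x = w then 1 else 0) := by
  rw [← Nat.card_sigma]
  symm
  have hmem (w : W) (H : SimpleGraph W) : H.attachLeaf w ∈ connectedWithDegrees d ↔
      H ∈ connectedWithDegrees fun x => d (some x) - if x = w then 1 else 0 := by
    simp only [connectedWithDegrees, Set.mem_ofPred_eq, connected_attachLeaf_iff, Option.forall,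
      card_neighborSet_attachLeaf_none, card_neighborSet_attachLeaf_some, hnone, true_and]
    refine and_congr_right fun hH => forall_congr' fun x => ?_
    have := hd (some x)
    split_ifs <;> omega
  refine Nat.card_eq_of_bijective
    (fun p => ⟨p.2.1.attachLeaf p.1, (hmem p.1 p.2.1).2 p.2.2⟩) ⟨?_, ?_⟩
  · rintro ⟨w, H, hH⟩ ⟨w', H', hH'⟩ h
    replace h : H.attachLeaf w = H'.attachLeaf w' := congrArg Subtype.val h
    obtain rfl : w = w' := by
      rw [← attachLeaf_adj_none_some H', ← h, attachLeaf_adj_none_some]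
    obtain rfl : H = H' := by
      ext x y
      rw [← attachLeaf_adj_some_some H w, h, attachLeaf_adj_some_some]
    rfl
  · rintro ⟨G, hG⟩
    have h1 := hG.2 none
    rw [hnone, Nat.card_coe_set_eq, Set.ncard_eq_one] at h1
    obtain ⟨_ | w, hw⟩ := h1
    · exact absurd (hw ▸ Set.mem_singleton none : none ∈ G.neighborSet none) (by simp)
    · have hGw := attachLeaf_comap_some w hw
      exact ⟨⟨w, G.comap some, (hmem _ _).1 (hGw.symm ▸ hG)⟩, Subtype.ext hGw⟩

lemma card_connectedWithDegrees_eq_zero {V : Type*} [Finite V] [Nontrivial V] {d : V → ℕ} {v : V}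
    (hv : d v = 0) : Nat.card (connectedWithDegrees d) = 0 := by
  rw [Nat.card_coe_set_eq, Set.ncard_eq_zero, Set.eq_empty_iff_forall_notMem]
  rintro G ⟨hG, hdeg⟩
  obtain ⟨w, hw⟩ := hG.preconnected.exists_adj_of_nontrivial v
  have h := hdeg v
  rw [hv, Nat.card_coe_set_eq, Set.ncard_eq_zero] at h
  exact (Set.ext_iff.1 h w).1 hw

lemma card_connectedWithDegrees_of_card_eq_two {V : Type*} [Fintype V] {d : V → ℕ}
    (hV : Fintype.card V = 2) (hd : ∀ i, d i = 1) : Nat.card (connectedWithDegrees d) = 1 := by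
  classical
  rw [Nat.card_coe_set_eq, Set.ncard_eq_one]
  refine ⟨⊤, Set.eq_singleton_iff_unique_mem.2 ⟨⟨?_, fun i => ?_⟩, ?_⟩⟩
  · have : Nonempty V := Fintype.card_pos_iff.1 (by omega)
    exact connected_top
  · rw [Nat.card_eq_fintype_card, card_neighborSet_eq_degree, complete_graph_degree, hV, hd]
  · rintro G ⟨-, hG⟩
    rw [← top_le_iff]
    intro a b (hab : a ≠ b)
    have h := hG a
    rw [hd, Nat.card_coe_set_eq, Set.ncard_eq_one] at h
    obtain ⟨c, hc⟩ := h
    have hac : G.Adj a c := (Set.ext_iff.1 hc c).2 rfl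
    suffices b = c by rwa [this]
    by_contra hbc
    have := Finset.card_le_univ {a, b, c}
    rw [Finset.card_eq_three.2 ⟨a, b, c, hab, hac.ne, hbc, rfl⟩] at this
    omega

theorem card_connectedWithDegrees_mul_prod_factorial (m : ℕ) :
    ∀ {V : Type} [Fintype V] (d : V → ℕ), Fintype.card V = m + 2 → (∀ i, 1 ≤ d i) →
      ∑ i, d i = 2 * (m + 1) →
      Nat.card (connectedWithDegrees d) * ∏ i, (d i - 1).factorial = m.factorial := by
  classical
  induction m with
  | zero =>
    intro V _ d hV hd hsum
    have hone : ∀ i, d i = 1 := by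
      have := (Finset.sum_eq_sum_iff_of_le (s := .univ) (f := fun _ => 1) (g := d)
        fun i _ => hd i).1 (by simp [hsum, hV])
      exact fun i => (this i (Finset.mem_univ i)).symm
    rw [card_connectedWithDegrees_of_card_eq_two hV hone]
    simp [hone]
  | succ m ih =>
    intro V _ d hV hd hsum
    obtain ⟨v, hv⟩ : ∃ v, d v = 1 := by
      by_contra! h
      have := Finset.card_nsmul_le_sum .univ d 2 fun i _ => by
        have := hd i
        have := h i
        omega
      rw [Finset.card_univ, hV, hsum] at this
      simp at this
      omega
    let e : Option {x // x ≠ v} ≃ V := Equiv.optionSubtypeNe v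
    obtain ⟨f, rfl⟩ : ∃ f, d = f ∘ e.symm := ⟨d ∘ e, by ext; simp⟩
    replace hd (i) : 1 ≤ f i := by simpa using hd (e i)
    replace hv : f none = 1 := by simpa [e] using hv
    have hW : Fintype.card {x // x ≠ v} = m + 2 := by
      have := Fintype.card_congr e
      rw [Fintype.card_option] at this
      omega
    have : Nontrivial {x // x ≠ v} := Fintype.one_lt_card_iff_nontrivial.1 (by omega)
    have hprod : ∏ i, ((f ∘ e.symm) i - 1).factorial = ∏ x, (f (some x) - 1).factorial := by
      rw [← e.prod_comp]
      simp [Fintype.prod_option, hv]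
    have hs : ∑ x, f (some x) = 2 * (m + 1) + 1 := by
      rw [← e.sum_comp] at hsum
      simp only [Function.comp_apply, Equiv.symm_apply_apply, Fintype.sum_option, hv] at hsum
      omega
    rw [card_connectedWithDegrees_congr, card_connectedWithDegrees_option f hd hv, hprod,
      Finset.sum_mul]
    have hterm (w : {x // x ≠ v}) :
        Nat.card (connectedWithDegrees fun x => f (some x) - if x = w then 1 else 0) *
          ∏ x, (f (some x) - 1).factorial = (f (some w) - 1) * m.factorial := by
      rcases (hd (some w)).eq_or_lt with h | h
      · rw [card_connectedWithDegrees_eq_zero (v := w) (by simp [← h]), ← h]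
        simp
      · have hsub : ∑ x, (f (some x) - if x = w then 1 else 0) = 2 * (m + 1) := by
          have : ∑ x, (f (some x) - if x = w then 1 else 0) + ∑ x, (if x = w then 1 else 0) =
              ∑ x, f (some x) := by
            rw [← Finset.sum_add_distrib]
            refine Finset.sum_congr rfl fun x _ => Nat.sub_add_cancel ?_
            have := hd (some x)
            split_ifs <;> omega
          simp only [Finset.sum_ite_eq', Finset.mem_univ, if_true] at this
          omega
        rw [← ih (fun x => f (some x) - if x = w then 1 else 0) hW ?_ hsub, mul_left_comm]
        · congr 1
          rw [← Finset.mul_prod_erase _ _ (Finset.mem_univ w),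
            ← Finset.mul_prod_erase (a := w) _ _ (Finset.mem_univ w), ← mul_assoc]
          congr 1
          · obtain ⟨k, hk⟩ := Nat.exists_eq_add_of_lt h
            simp [hk, Nat.add_comm 1 k, Nat.factorial_succ]
          · refine Finset.prod_congr rfl fun x hx => ?_
            simp [Finset.ne_of_mem_erase hx]
        · intro x
          have := hd (some x)
          split_ifs with hx
          · subst hx; omega
          · omega
    have hsub : ∑ x, (f (some x) - 1) = m + 1 := by
      have : ∑ x, (f (some x) - 1) + ∑ x : {x // x ≠ v}, 1 = ∑ x, f (some x) := by
        rw [← Finset.sum_add_distrib]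
        exact Finset.sum_congr rfl fun x _ => Nat.sub_add_cancel (hd _)
      simp only [Finset.sum_const, Finset.card_univ, hW, smul_eq_mul, mul_one] at this
      omega
    rw [Finset.sum_congr rfl fun w _ => hterm w, ← Finset.sum_mul, hsub, Nat.factorial_succ]

end SimpleGraph

theorem stmt_13 (n : ℕ) (hn : 2 ≤ n) (d : Fin n → ℕ) (hd : ∀ i, 1 ≤ d i)
    (hsum : ∑ i, d i = 2 * (n - 1)) :
    Nat.card {G : SimpleGraph (Fin n) //
        G.IsTree ∧ ∀ i, Nat.card (G.neighborSet i) = d i} =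
      (n - 2).factorial / ∏ i, (d i - 1).factorial := by
  have hcard : Nat.card {G : SimpleGraph (Fin n) //
      G.IsTree ∧ ∀ i, Nat.card (G.neighborSet i) = d i} =
      Nat.card (SimpleGraph.connectedWithDegrees d) :=
    Nat.card_congr <| Equiv.subtypeEquivRight fun G => and_congr_left fun hG =>
      SimpleGraph.isTree_iff_connected_of_sum_eq (by simpa using hsum) hG
  rw [hcard, ← SimpleGraph.card_connectedWithDegrees_mul_prod_factorial (n - 2) d
    (by simp; omega) hd (by omega)]
  exact (Nat.mul_div_cancel _ (Finset.prod_pos fun i _ => Nat.factorial_pos _)).symm
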